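/- Let B be a group, φ an injective endomorphism of B, and B(φ) = ⟨B, t ; t⁻¹bt = bφ (b ∈ B)⟩ the corresponding descending HNN-extension. If b ∈ B is such that b ∉ Bφ, then the cyclic subgroup of B(φ) generated by t and the cyclic subgroup generated by tb intersect trivially. -/

import Mathlib

/-- A group has the Howson property if the intersection of any two finitely
generated subgroups is finitely generated. -/
def HowsonGroup (G : Type*) [Group G] : Prop :=
  ∀ H K : Subgroup G, H.FG → K.FG → (H ⊓ K).FG

/-- The descending HNN-extension `G(φ) = ⟨G, t ; t⁻¹ g t = gφ (g ∈ G)⟩` of a group `G`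
with respect to an injective endomorphism `φ`, realized as the Mathlib `HNNExtension`
with base `G`, associated subgroups `φ.range` and `G` (i.e. `⊤`), so that the relation
`t⁻¹ * of g * t = of (φ g)` holds for all `g : G`. -/
abbrev DescHNN {G : Type*} [Group G] (φ : G →* G) (hφ : Function.Injective φ) : Type _ :=
  HNNExtension G (MonoidHom.range φ) ⊤
    ((MonoidHom.ofInjective hφ).symm.trans Subgroup.topEquiv.symm)

namespace DescHNN

open HNNExtension

variable {B : Type*} [Group B] (φ : B →* B) (hφ : Function.Injective φ)

theorem of_mul_t (g : B) :
    (of g * t : DescHNN φ hφ) = t * of (φ g) :=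
  HNNExtension.of_mul_t (A := φ.range) (B := ⊤)
    (φ := (MonoidHom.ofInjective hφ).symm.trans Subgroup.topEquiv.symm) ⟨g, Subgroup.mem_top g⟩

/-- The exponent sum of the stable letter. -/
noncomputable def exponentSum : DescHNN φ hφ →* Multiplicative ℤ :=
  lift 1 (Multiplicative.ofAdd 1) (by simp)

theorem exists_t_mul_of_pow_succ (b : B) (n : ℕ) :
    ∃ g : B, (t * of b : DescHNN φ hφ) ^ (n + 1) = t ^ (n + 1) * of (φ g * b) := by
  induction n with
  | zero => exact ⟨1, by simp⟩
  | succ n ih =>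
    obtain ⟨g, hg⟩ := ih
    refine ⟨φ g * b, ?_⟩
    rw [pow_succ, hg, map_mul of (φ (φ g * b)) b, pow_succ t (n + 1), mul_assoc,
      ← mul_assoc (of _) t, of_mul_t]
    simp only [mul_assoc]

theorem t_mul_of_pow_ne_t_pow {b : B} (hb : b ∉ φ.range) {n : ℕ} (hn : n ≠ 0) :
    (t * of b : DescHNN φ hφ) ^ n ≠ t ^ n := by
  obtain ⟨k, rfl⟩ := Nat.exists_eq_succ_of_ne_zero hn
  obtain ⟨g, hg⟩ := exists_t_mul_of_pow_succ φ hφ b k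
  intro h
  have h1 : (of (φ g * b) : DescHNN φ hφ) = 1 := mul_eq_left.mp (hg.symm.trans h)
  have h2 : φ g * b = 1 := of_injective _ (h1.trans (map_one _).symm)
  exact hb ⟨g⁻¹, by rw [map_inv, inv_eq_of_mul_eq_one_right h2]⟩

end DescHNN

/-- Let `B` be a group, `φ` an injective endomorphism of `B`, and `B(φ)` the
corresponding descending HNN-extension. If `b ∈ B` is such that `b ∉ Bφ`, then the cyclic
subgroup of `B(φ)` generated by `t` and the cyclic subgroup generated by `tb` intersect
trivially. -/
theorem zpowers_t_inter_zpowers_tb {B : Type*} [Group B]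
    (φ : B →* B) (hφ : Function.Injective φ)
    (b : B) (hb : b ∉ MonoidHom.range φ) :
    Subgroup.zpowers (HNNExtension.t : DescHNN φ hφ)
      ⊓ Subgroup.zpowers (HNNExtension.t * HNNExtension.of b) = ⊥ := by
  rw [eq_bot_iff]
  rintro x ⟨⟨m, rfl⟩, ⟨n, h⟩⟩
  dsimp only at h ⊢
  have hnm : n = m := by
    simpa [DescHNN.exponentSum, ← ofAdd_zsmul] using
      congrArg (DescHNN.exponentSum φ hφ) h
  subst hnm
  by_contra hx
  have hn : n.natAbs ≠ 0 := by
    rintro h0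
    exact hx (by simp [Int.natAbs_eq_zero.mp h0])
  refine DescHNN.t_mul_of_pow_ne_t_pow φ hφ hb hn ?_
  rcases Int.natAbs_eq n with h' | h' <;> rw [h'] at h
  · simpa only [zpow_natCast] using h
  · simpa only [zpow_neg, zpow_natCast, inv_inj] using h
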